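/- arXiv:2508.08336 — 4 statements merged into one kernel-verified Lean document; each statement's English description precedes it below -/
import Mathlib

section
/- Let the model space be Γ = {0,1}^p, let p(y|γ) > 0 be fixed positive weights, and suppose π(γ|ω) = ∏_{j=1}^p m_j(ω)^{γ_j} (1 − m_j(ω))^{1−γ_j}, where each m_j : R^q → (0,1) is differentiable. With p(y|ω) = Σ_γ p(y|γ) π(γ|ω), π(γ|y,ω) = p(y|γ) π(γ|ω)/p(y|ω), and π(γ_j = 1|y,ω) = Σ_{γ : γ_j = 1} π(γ|y,ω), one has ∇_ω log p(y|ω) = Σ_{j=1}^p [∇_ω m_j(ω) / (m_j(ω)(1 − m_j(ω)))] · (π(γ_j = 1|y,ω) − m_j(ω)). -/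
noncomputable section

/-- The derivative of an independent Bernoulli probability, in score form. -/
theorem hasFDerivAt_bernoulli_prod {ι E : Type*} [Fintype ι] [DecidableEq ι]
    [NormedAddCommGroup E] [NormedSpace ℝ E] {m : ι → E → ℝ} {m' : ι → E →L[ℝ] ℝ} {x : E}
    (hm : ∀ j, m j x ∈ Set.Ioo (0 : ℝ) 1) (hm' : ∀ j, HasFDerivAt (m j) (m' j) x)
    (γ : Finset ι) :
    HasFDerivAt (fun y => ∏ j, if j ∈ γ then m j y else 1 - m j y)
      (∑ j, ((∏ i, if i ∈ γ then m i x else 1 - m i x) *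
        (((if j ∈ γ then 1 else 0) - m j x) / (m j x * (1 - m j x)))) • m' j) x := by
  have hfactor : ∀ j ∈ Finset.univ, HasFDerivAt (fun y => if j ∈ γ then m j y else 1 - m j y)
      ((if j ∈ γ then (1 : ℝ) else -1) • m' j) x := by
    intro j _
    split_ifs
    · simpa using hm' j
    · exact ((hm' j).const_sub 1).congr_fderiv (neg_one_smul ℝ (m' j)).symm
  refine (HasFDerivAt.finsetProd hfactor).congr_fderiv (Finset.sum_congr rfl fun j _ => ?_)
  have h0 : m j x ≠ 0 := (hm j).1.ne'
  have h1 : 1 - m j x ≠ 0 := (sub_pos.2 (hm j).2).ne'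
  rw [smul_smul, ← Finset.mul_prod_erase Finset.univ _ (Finset.mem_univ j)]
  congr 1
  split_ifs <;> field_simp
  ring

/-- **Gradient of the log marginal likelihood for independent Bernoulli model priors.**
Models are `γ ∈ {0,1}^p` (encoded as `Finset (Fin p)`), `w γ = p(y|γ) > 0` are fixed
positive weights, and `π(γ|ω) = ∏_j m_j(ω)^{γ_j} (1−m_j(ω))^{1−γ_j}` with each
`m_j : ℝ^q → (0,1)` differentiable. Then, with
`π(γ_j = 1|y,ω) = Σ_{γ ∋ j} p(y|γ)π(γ|ω)/p(y|ω)`,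
`∇_ω log p(y|ω) = Σ_j [∇m_j(ω)/(m_j(ω)(1−m_j(ω)))] (π(γ_j=1|y,ω) − m_j(ω))`. -/
theorem stmt_3 {q p : ℕ}
    (w : Finset (Fin p) → ℝ) (hw : ∀ γ, 0 < w γ)
    (m : Fin p → (Fin q → ℝ) → ℝ)
    (hm : ∀ j ω, m j ω ∈ Set.Ioo (0 : ℝ) 1)
    (hdiff : ∀ j, Differentiable ℝ (m j))
    (prior : (Fin q → ℝ) → Finset (Fin p) → ℝ)
    (hprior : ∀ ω γ, prior ω γ = ∏ j, if j ∈ γ then m j ω else 1 - m j ω)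
    (ω : Fin q → ℝ) :
    fderiv ℝ (fun ω' => Real.log (∑ γ, w γ * prior ω' γ)) ω =
      ∑ j, (((∑ γ, if j ∈ γ then w γ * prior ω γ / ∑ γ', w γ' * prior ω γ' else 0)
            - m j ω) / (m j ω * (1 - m j ω))) • fderiv ℝ (m j) ω := by
  set Z := ∑ γ, w γ * prior ω γ with hZ
  have hprior_pos : ∀ γ, 0 < prior ω γ := by
    intro γ
    rw [hprior]
    refine Finset.prod_pos fun j _ => ?_
    split_ifs
    exacts [(hm j ω).1, sub_pos.2 (hm j ω).2]
  have hZ_pos : 0 < Z :=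
    Finset.sum_pos (fun γ _ => mul_pos (hw γ) (hprior_pos γ)) Finset.univ_nonempty
  have hprior_deriv : ∀ γ, HasFDerivAt (fun ω' => prior ω' γ)
      (∑ j, (prior ω γ * (((if j ∈ γ then 1 else 0) - m j ω) / (m j ω * (1 - m j ω)))) •
        fderiv ℝ (m j) ω) ω := by
    intro γ
    simp only [hprior]
    exact hasFDerivAt_bernoulli_prod (fun j => hm j ω) (fun j => (hdiff j ω).hasFDerivAt) γ
  have hsum := HasFDerivAt.fun_sum (u := Finset.univ)
    fun γ _ => (hprior_deriv γ).const_mul (w γ)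
  rw [(hsum.log hZ_pos.ne').fderiv]
  simp only [Finset.smul_sum, smul_smul]
  rw [Finset.sum_comm]
  refine Finset.sum_congr rfl fun j _ => ?_
  rw [← Finset.sum_smul]
  congr 1
  have hmean : m j ω = ∑ γ, w γ * prior ω γ / Z * m j ω := by
    rw [← Finset.sum_mul, ← Finset.sum_div, ← hZ, div_self hZ_pos.ne', one_mul]
  conv_rhs => rw [sub_eq_add_neg, div_eq_mul_inv]
  nth_rewrite 4 [hmean]
  rw [← sub_eq_add_neg, ← Finset.sum_sub_distrib, Finset.sum_mul]
  refine Finset.sum_congr rfl fun γ _ => ?_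
  split_ifs <;> ring
end
end

section
/- Let ρ be a probability mass function on Γ = {0,1}^p, let π(γ|ω) = ∏_{j=1}^p m_j(ω)^{γ_j}(1 − m_j(ω))^{1−γ_j} with each m_j : R^q → (0,1) differentiable, and define f(ω) = Σ_{γ∈Γ} ρ(γ) log π(γ|ω). Then ∇_ω f(ω) = Σ_{j=1}^p [∇_ω m_j(ω) / (m_j(ω)(1 − m_j(ω)))] · (ρ_j − m_j(ω)), where ρ_j = Σ_{γ : γ_j = 1} ρ(γ). -/
noncomputable section

/-- The score of a product of independent Bernoulli laws with differentiable success
probabilities `m j`, evaluated at the outcome `γ`. -/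
theorem hasFDerivAt_log_prod_bernoulli {ι E : Type*} [Fintype ι] [DecidableEq ι]
    [NormedAddCommGroup E] [NormedSpace ℝ E] {m : ι → E → ℝ} {m' : ι → E →L[ℝ] ℝ} {x : E}
    (hm : ∀ j y, m j y ∈ Set.Ioo (0 : ℝ) 1) (hd : ∀ j, HasFDerivAt (m j) (m' j) x)
    (γ : Finset ι) :
    HasFDerivAt (fun y => Real.log (∏ j, if j ∈ γ then m j y else 1 - m j y))
      (∑ j, (((if j ∈ γ then 1 else 0) - m j x) / (m j x * (1 - m j x))) • m' j) x := by
  have h_pos : ∀ j y, 0 < m j y := fun j y => (hm j y).1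
  have h_sub_pos : ∀ j y, 0 < 1 - m j y := fun j y => sub_pos.2 (hm j y).2
  have h_log : (fun y => Real.log (∏ j, if j ∈ γ then m j y else 1 - m j y)) =
      fun y => ∑ j, Real.log (if j ∈ γ then m j y else 1 - m j y) := by
    funext y
    refine Real.log_prod fun j _ => ?_
    split_ifs
    exacts [(h_pos j y).ne', (h_sub_pos j y).ne']
  rw [h_log]
  refine HasFDerivAt.fun_sum fun j _ => ?_
  have h_ne := (h_pos j x).ne'
  have h_sub_ne := (h_sub_pos j x).ne'
  by_cases hj : j ∈ γ
  · simp only [hj, if_true]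
    have h_coeff : (1 - m j x) / (m j x * (1 - m j x)) = (m j x)⁻¹ := by field_simp
    rw [h_coeff]
    exact (hd j).log h_ne
  · simp only [hj, if_false]
    have h_coeff : (0 - m j x) / (m j x * (1 - m j x)) = -(1 - m j x)⁻¹ := by
      field_simp
      ring
    rw [h_coeff]
    refine (((hd j).const_sub 1).log h_sub_ne).congr_fderiv ?_
    ext v
    simp

/-- **Gradient of the expected complete-data log model prior (E-step objective).**
`ρ` is a probability mass function on `Γ = {0,1}^p` (encoded as `Finset (Fin p)`),
`π(γ|ω) = ∏_j m_j(ω)^{γ_j}(1−m_j(ω))^{1−γ_j}` with each `m_j : ℝ^q → (0,1)`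
differentiable, and `f(ω) = Σ_γ ρ(γ) log π(γ|ω)`. Then
`∇_ω f(ω) = Σ_j [∇m_j(ω)/(m_j(ω)(1−m_j(ω)))] (ρ_j − m_j(ω))`, where
`ρ_j = Σ_{γ ∋ j} ρ(γ)`. -/
theorem stmt_5 {q p : ℕ}
    (ρ : Finset (Fin p) → ℝ) (hρ : ∀ γ, 0 ≤ ρ γ) (hρ1 : ∑ γ, ρ γ = 1)
    (m : Fin p → (Fin q → ℝ) → ℝ)
    (hm : ∀ j ω, m j ω ∈ Set.Ioo (0 : ℝ) 1)
    (hdiff : ∀ j, Differentiable ℝ (m j))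
    (f : (Fin q → ℝ) → ℝ)
    (hf : ∀ ω, f ω = ∑ γ, ρ γ * Real.log (∏ j, if j ∈ γ then m j ω else 1 - m j ω))
    (ω : Fin q → ℝ) :
    fderiv ℝ f ω =
      ∑ j, (((∑ γ, if j ∈ γ then ρ γ else 0) - m j ω) / (m j ω * (1 - m j ω))) •
        fderiv ℝ (m j) ω := by
  rw [funext hf]
  have h_deriv := HasFDerivAt.fun_sum (u := Finset.univ) fun γ _ =>
    (hasFDerivAt_log_prod_bernoulli hm
      (fun j => (hdiff j ω).hasFDerivAt) γ).const_mul (ρ γ)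
  rw [h_deriv.fderiv]
  simp only [Finset.smul_sum, smul_smul]
  rw [Finset.sum_comm]
  refine Finset.sum_congr rfl fun j _ => ?_
  rw [← Finset.sum_smul]
  congr 1
  simp only [mul_div_assoc', mul_sub, mul_ite, mul_one, mul_zero]
  rw [← Finset.sum_div, Finset.sum_sub_distrib, ← Finset.sum_mul, hρ1, one_mul]
end
end

section
/- Let Z be a p×q real matrix whose set of distinct rows forms a q×q invertible matrix U, let m_j(ω) = (1 + e^{−z_jᵀω})^{-1} where z_jᵀ is the j-th row of Z, let ρ̂ = (ρ̂_1,…,ρ̂_p)ᵀ ∈ [0,1]^p, let g > 0, and let f(ω) = Σ_{j=1}^p [ρ̂_j log m_j(ω) + (1−ρ̂_j) log(1 − m_j(ω))] and log π(ω) = −(1/(2g)) ωᵀ(ZᵀZ/p)ω (up to an additive constant). For c > 0 let h(a,c) denote the unique real solution w of 1/(1+e^{−w}) + w/c = a. Set Z̃ = Z U^{-1}, a_j = (Σ_{i=1}^p z̃_{ij} ρ̂_i)/(Σ_{i=1}^p z̃_{ij}), ω̃_j = h(a_j, g p) for j = 1,…,q, and ω̂ = U^{-1} ω̃. Then ∇_ω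 f(ω̂) + ∇_ω log π(ω̂) = 0. -/
open Matrix

noncomputable section

/-- The linear form `v ↦ z_jᵀ v` given by the `j`-th row of a real matrix. -/
def rowForm {p q : ℕ} (Z : Matrix (Fin p) (Fin q) ℝ) (j : Fin p) : (Fin q → ℝ) →L[ℝ] ℝ :=
  (ContinuousLinearMap.proj j).comp (LinearMap.toContinuousLinearMap Z.mulVecLin)

theorem rowForm_apply {p q : ℕ} (Z : Matrix (Fin p) (Fin q) ℝ) (j : Fin p) (v : Fin q → ℝ) :
    rowForm Z j v = Z j ⬝ᵥ v := rfl

/-- The derivative of the Bernoulli log-likelihood in the logit `t` is the residual. -/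
theorem hasDerivAt_bernoulli_logLik (r t : ℝ) :
    HasDerivAt (fun t : ℝ => r * Real.log (1 + Real.exp (-t))⁻¹ +
      (1 - r) * Real.log (1 - (1 + Real.exp (-t))⁻¹)) (r - (1 + Real.exp (-t))⁻¹) t := by
  have key : (fun t : ℝ => r * Real.log (1 + Real.exp (-t))⁻¹ +
      (1 - r) * Real.log (1 - (1 + Real.exp (-t))⁻¹)) =
      fun t => -Real.log (1 + Real.exp (-t)) - (1 - r) * t := by
    funext t
    have hpos : 0 < 1 + Real.exp (-t) := by positivity
    have hsub : 1 - (1 + Real.exp (-t))⁻¹ = Real.exp (-t) / (1 + Real.exp (-t)) := by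
      field_simp
      ring
    rw [hsub, Real.log_div (Real.exp_pos _).ne' hpos.ne', Real.log_exp, Real.log_inv]
    ring
  rw [key]
  have hpos : 1 + Real.exp (-t) ≠ 0 := by positivity
  have hlog := (((hasDerivAt_neg t).exp).const_add 1).log hpos
  refine (hlog.neg.sub ((hasDerivAt_id t).const_mul (1 - r))).congr_deriv ?_
  field_simp
  ring

theorem hasFDerivAt_logistic_logLik {p q : ℕ} (Z : Matrix (Fin p) (Fin q) ℝ) (ρ : Fin p → ℝ)
    (ω : Fin q → ℝ) :
    HasFDerivAt (fun ω => ∑ j, (ρ j * Real.log (1 + Real.exp (-(Z j ⬝ᵥ ω)))⁻¹ +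
        (1 - ρ j) * Real.log (1 - (1 + Real.exp (-(Z j ⬝ᵥ ω)))⁻¹)))
      (∑ j, (ρ j - (1 + Real.exp (-(Z j ⬝ᵥ ω)))⁻¹) • rowForm Z j) ω :=
  HasFDerivAt.fun_sum fun j _ =>
    (hasDerivAt_bernoulli_logLik (ρ j) (Z j ⬝ᵥ ω)).comp_hasFDerivAt ω (rowForm Z j).hasFDerivAt

theorem dotProduct_smul_gram_mulVec {p q : ℕ} (Z : Matrix (Fin p) (Fin q) ℝ) (c : ℝ)
    (ω : Fin q → ℝ) : ω ⬝ᵥ ((c • (Zᵀ * Z)) *ᵥ ω) = c * ∑ j, (Z j ⬝ᵥ ω) ^ 2 := by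
  rw [smul_mulVec, dotProduct_smul, ← mulVec_mulVec, dotProduct_mulVec, vecMul_transpose,
    smul_eq_mul]
  simp [dotProduct, mulVec, sq]

theorem hasFDerivAt_gram_quadratic {p q : ℕ} (Z : Matrix (Fin p) (Fin q) ℝ) (b c : ℝ)
    (ω : Fin q → ℝ) :
    HasFDerivAt (fun ω => b * (ω ⬝ᵥ ((c • (Zᵀ * Z)) *ᵥ ω)))
      (∑ j, (2 * b * c * (Z j ⬝ᵥ ω)) • rowForm Z j) ω := by
  have hsum : (fun ω => b * (ω ⬝ᵥ ((c • (Zᵀ * Z)) *ᵥ ω))) =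
      fun ω => ∑ j, b * c * (Z j ⬝ᵥ ω) ^ 2 := by
    funext ω
    rw [dotProduct_smul_gram_mulVec, ← mul_assoc, Finset.mul_sum]
  rw [hsum]
  refine HasFDerivAt.fun_sum fun j _ => ?_
  have hsq : HasDerivAt (fun t : ℝ => b * c * t ^ 2) (2 * b * c * (Z j ⬝ᵥ ω)) (Z j ⬝ᵥ ω) :=
    ((hasDerivAt_pow 2 (Z j ⬝ᵥ ω)).const_mul (b * c)).congr_deriv (by push_cast; ring)
  exact hsq.comp_hasFDerivAt ω (rowForm Z j).hasFDerivAt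

/-- Residuals from the means over the fibres of a map are orthogonal to every function that is
constant on the fibres. -/
theorem sum_sub_fiber_mean_mul_eq_zero {ι κ : Type*} [Fintype ι] [Fintype κ] [DecidableEq κ]
    (σ : ι → κ) (ρ : ι → ℝ) (a u : κ → ℝ)
    (ha : ∀ k, a k = (∑ i, (if σ i = k then 1 else 0) * ρ i) / ∑ i, if σ i = k then 1 else 0) :
    ∑ i, (ρ i - a (σ i)) * u (σ i) = 0 := by
  rw [← Finset.sum_fiberwise (s := Finset.univ) (g := σ)]
  refine Finset.sum_eq_zero fun k _ => ?_
  have hfib : ∑ i with σ i = k, (ρ i - a (σ i)) * u (σ i) =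
      (∑ i with σ i = k, ρ i - (Finset.univ.filter (σ · = k)).card * a k) * u k := by
    rw [← nsmul_eq_mul, ← Finset.sum_const, ← Finset.sum_sub_distrib, Finset.sum_mul]
    refine Finset.sum_congr rfl fun i hi => ?_
    rw [(Finset.mem_filter.mp hi).2]
  rw [hfib]
  rcases (Finset.univ.filter (σ · = k)).eq_empty_or_nonempty with he | hne
  · simp [he]
  · have hcard : ((Finset.univ.filter (σ · = k)).card : ℝ) ≠ 0 := by
      exact_mod_cast hne.card_pos.ne'
    have hak : a k = (∑ i with σ i = k, ρ i) / (Finset.univ.filter (σ · = k)).card := by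
      simp [ha, Finset.sum_filter]
    rw [hak, mul_div_cancel₀ _ hcard, sub_self, zero_mul]

/-- **Closed-form M-step when the meta-covariates partition the covariates.**
`Z ∈ ℝ^{p×q}` has its set of distinct rows equal to the rows of an invertible
`q×q` matrix `U`. With `m_j(ω) = (1 + e^{−z_jᵀω})⁻¹`, `ρ̂ ∈ [0,1]^p`, `g > 0`,
`f(ω) = Σ_j [ρ̂_j log m_j(ω) + (1−ρ̂_j) log(1−m_j(ω))]`,
`log π(ω) = −(1/(2g)) ωᵀ(ZᵀZ/p)ω` (up to a constant), `h(a,c)` the solution of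
`1/(1+e^{−w}) + w/c = a`, `Z̃ = Z U⁻¹`, `a_j = (Σ_i z̃_{ij} ρ̂_i)/(Σ_i z̃_{ij})`,
`ω̃_j = h(a_j, gp)` and `ω̂ = U⁻¹ ω̃`, one has `∇f(ω̂) + ∇ log π(ω̂) = 0`. -/
theorem stmt_7 {p q : ℕ} (Z : Matrix (Fin p) (Fin q) ℝ) (U : Matrix (Fin q) (Fin q) ℝ)
    (hU : IsUnit U.det)
    (hZU : ∀ j, ∃ k, Z j = U k) (hUZ : ∀ k, ∃ j, U k = Z j)
    (ρ : Fin p → ℝ) (hρ : ∀ j, ρ j ∈ Set.Icc (0 : ℝ) 1)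
    (g : ℝ) (hg : 0 < g)
    (m : Fin p → (Fin q → ℝ) → ℝ)
    (hm : ∀ j ω, m j ω = (1 + Real.exp (-(Z j ⬝ᵥ ω)))⁻¹)
    (f lp : (Fin q → ℝ) → ℝ)
    (hf : ∀ ω, f ω = ∑ j, (ρ j * Real.log (m j ω) + (1 - ρ j) * Real.log (1 - m j ω)))
    (hlp : ∀ ω, lp ω = -(1 / (2 * g)) * (ω ⬝ᵥ (((p : ℝ)⁻¹ • (Zᵀ * Z)) *ᵥ ω)))
    (h : ℝ → ℝ → ℝ)
    (hh : ∀ a c : ℝ, 0 < c → (1 + Real.exp (-(h a c)))⁻¹ + h a c / c = a)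
    (Zt : Matrix (Fin p) (Fin q) ℝ) (hZt : Zt = Z * U⁻¹)
    (a : Fin q → ℝ) (ha : ∀ k, a k = (∑ i, Zt i k * ρ i) / ∑ i, Zt i k)
    (ωt : Fin q → ℝ) (hωt : ∀ k, ωt k = h (a k) (g * p))
    (ωhat : Fin q → ℝ) (hωhat : ωhat = U⁻¹ *ᵥ ωt) :
    fderiv ℝ f ωhat + fderiv ℝ lp ωhat = 0 := by
  choose σ hσ using hZU
  have hfd : HasFDerivAt f _ ωhat :=
    ((hasFDerivAt_logistic_logLik Z ρ ωhat).congr_of_eventuallyEq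
      (.of_forall fun ω => by simp only [hf, hm]))
  have hlpd : HasFDerivAt lp _ ωhat :=
    ((hasFDerivAt_gram_quadratic Z (-(1 / (2 * g))) (p : ℝ)⁻¹ ωhat).congr_of_eventuallyEq
      (.of_forall hlp))
  rw [hfd.fderiv, hlpd.fderiv, ← Finset.sum_add_distrib]
  have hZt_apply : ∀ i k, Zt i k = if σ i = k then 1 else 0 := fun i k => by
    rw [hZt, mul_apply_eq_vecMul, hσ, ← mul_apply_eq_vecMul, mul_nonsing_inv U hU, one_apply]
  have hlogit : ∀ j, Z j ⬝ᵥ ωhat = ωt (σ j) := fun j => by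
    rw [hσ, hωhat]
    change (U *ᵥ (U⁻¹ *ᵥ ωt)) (σ j) = ωt (σ j)
    rw [mulVec_mulVec, mul_nonsing_inv U hU, one_mulVec]
  ext1 v
  have hmean := sum_sub_fiber_mean_mul_eq_zero σ ρ a (U *ᵥ v)
    (fun k => by simpa only [hZt_apply] using ha k)
  rw [_root_.sum_apply, _root_.zero_apply, ← hmean]
  refine Finset.sum_congr rfl fun j _ => ?_
  have hp : (0 : ℝ) < p := by exact_mod_cast j.pos
  have hroot := hh (a (σ j)) (g * p) (mul_pos hg hp)
  rw [← hωt] at hroot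
  rw [← hroot, _root_.add_apply, _root_.smul_apply,
    _root_.smul_apply, rowForm_apply, hlogit, smul_eq_mul, smul_eq_mul, hσ]
  change _ = _ * (U (σ j) ⬝ᵥ v)
  field_simp
  ring
end
end

section
/- In the Gaussian linear model with Zellner prior, for any model γ and any γ̃ ⊆ γ*, with Γ(γ,γ̃) = γ ∪ γ̃ one has both μ(Γ(γ,γ̃), γ̃) ≤ n φ^{-1} λ̄ Σ_{b=1}^B |(γ*_b ∩ γ_b) ∖ γ̃_b| · max_{i ∈ (γ*_b ∩ γ_b) ∖ γ̃_b} (θ*_i)², where λ̄ = λ_max((1/n) X_{γ*}ᵀ X_{γ*}), and μ(Γ(γ,γ̃), γ̃) ≥ n φ^{-1} λ_min((1/n) X_{γ*}ᵀ X_{γ*}) Σ_{b=1}^B |(γ*_b ∩ γ_b) ∖ γ̃_b| · min_{i ∈ (γ*_b ∩ γ_b) ∖ γ̃_b} (θ*_i)². -/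
open MeasureTheory ProbabilityTheory Matrix Filter Topology Asymptotics

noncomputable section

namespace Paper

variable {n B : ℕ} {ι : Type*} [DecidableEq ι]

/-- Submatrix `X_γ` of the columns of `X` selected by the model `γ`. -/
def subcols (X : Fin n → ι → ℝ) (γ : Finset ι) : Matrix (Fin n) {j // j ∈ γ} ℝ :=
  fun i j => X i j.1

/-- Gram matrix `X_γᵀ X_γ`. -/
def gram (X : Fin n → ι → ℝ) (γ : Finset ι) : Matrix {j // j ∈ γ} {j // j ∈ γ} ℝ :=
  (subcols X γ)ᵀ * subcols X γ

/-- Least squares estimate `θ̂_γ = (X_γᵀX_γ)⁻¹ X_γᵀ y`. -/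
def lse (X : Fin n → ι → ℝ) (γ : Finset ι) (y : Fin n → ℝ) : {j // j ∈ γ} → ℝ :=
  (gram X γ)⁻¹ *ᵥ ((subcols X γ)ᵀ *ᵥ y)

/-- The fit statistic `θ̂_γᵀ X_γᵀ X_γ θ̂_γ`. -/
def fitStat (X : Fin n → ι → ℝ) (γ : Finset ι) (y : Fin n → ℝ) : ℝ :=
  lse X γ y ⬝ᵥ (gram X γ *ᵥ lse X γ y)

/-- Projection matrix `P_γ = X_γ (X_γᵀX_γ)⁻¹ X_γᵀ`. -/
def projMat (X : Fin n → ι → ℝ) (γ : Finset ι) : Matrix (Fin n) (Fin n) ℝ :=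
  subcols X γ * (gram X γ)⁻¹ * (subcols X γ)ᵀ

/-- Number of covariates of `γ` lying in block `b`. -/
def blockCount (z : ι → Fin B) (γ : Finset ι) (b : Fin B) : ℕ :=
  (γ.filter fun j => z j = b).card

/-- Unnormalized posterior weight of model `γ` (proportional to `p(y|γ) π(γ|ω)`). -/
def postWeight (X : Fin n → ι → ℝ) (z : ι → Fin B) (φ g : ℝ) (ω : Fin B → ℝ)
    (y : Fin n → ℝ) (γ : Finset ι) : ℝ :=
  Real.exp (g * n * fitStat X γ y / (2 * φ * (1 + g * n))) *
    ∏ b : Fin B, (ω b / (Real.sqrt (1 + g * n) * (1 - ω b))) ^ blockCount z γ b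

/-- Posterior probability `π(γ | y, ω)` among the considered models. -/
def post (X : Fin n → ι → ℝ) (z : ι → Fin B) (models : Finset (Finset ι))
    (φ g : ℝ) (ω : Fin B → ℝ) (y : Fin n → ℝ) (γ : Finset ι) : ℝ :=
  postWeight X z φ g ω y γ / ∑ γ' ∈ models, postWeight X z φ g ω y γ'

/-- Posterior inclusion probability `π(γ_j = 1 | y, ω) = Σ_{γ ∋ j} π(γ | y, ω)`. -/
def pip (X : Fin n → ι → ℝ) (z : ι → Fin B) (models : Finset (Finset ι))
    (φ g : ℝ) (ω : Fin B → ℝ) (y : Fin n → ℝ) (j : ι) : ℝ :=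
  ∑ γ ∈ models.filter (fun γ => j ∈ γ), post X z models φ g ω y γ

/-- The Gaussian measure `N(mean, φ I_n)` on `Fin n → ℝ`. -/
def gaussPi (n : ℕ) (mean : Fin n → ℝ) (φ : ℝ) : Measure (Fin n → ℝ) :=
  Measure.pi fun i => gaussianReal (mean i) φ.toNNReal

/-- The vector `X_s θ_s`, i.e. the combination of the columns of `X` in `s`
with coefficients `θ`. -/
def colComb (X : Fin n → ι → ℝ) (θ : ι → ℝ) (s : Finset ι) : Fin n → ℝ :=
  fun i => ∑ j ∈ s, X i j * θ j

/-- Smallest eigenvalue of a symmetric real matrix, as the infimum of the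
Rayleigh quotient. -/
def eigMin {m : Type*} [Fintype m] (M : Matrix m m ℝ) : ℝ :=
  ⨅ x : {v : m → ℝ // v ≠ 0}, (x.1 ⬝ᵥ (M *ᵥ x.1)) / (x.1 ⬝ᵥ x.1)

/-- Largest eigenvalue of a symmetric real matrix, as the supremum of the
Rayleigh quotient. -/
def eigMax {m : Type*} [Fintype m] (M : Matrix m m ℝ) : ℝ :=
  ⨆ x : {v : m → ℝ // v ≠ 0}, (x.1 ⬝ᵥ (M *ᵥ x.1)) / (x.1 ⬝ᵥ x.1)

/-- Noncentrality parameter `μ(γ, γ̃) = φ⁻¹ ‖(I − P_γ̃) X_{γ∖γ̃} θ_{γ∖γ̃}‖²`. -/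
def muNC (X : Fin n → ι → ℝ) (θ : ι → ℝ) (φ : ℝ) (γ γt : Finset ι) : ℝ :=
  φ⁻¹ * ∑ i, (((1 - projMat X γt) *ᵥ colComb X θ (γ \ γt)) i) ^ 2

/-- `ρ(X)`: minimum over considered models `γ` with `γ ⊉ γ*` of the smallest
eigenvalue of `(1/n) X_{γ*∖γ}ᵀ (I − P_γ) X_{γ*∖γ}`. -/
def rhoX (X : Fin n → ι → ℝ) (models : Finset (Finset ι)) (γstar : Finset ι) : ℝ :=
  sInf ((fun γ => eigMin ((n : ℝ)⁻¹ •
      ((subcols X (γstar \ γ))ᵀ * (1 - projMat X γ) * subcols X (γstar \ γ)))) ''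
    {γ | γ ∈ models ∧ ¬ γstar ⊆ γ})

/-- Block penalty `κ_b = (1/2) log(1 + g n) + log(1/ω_b − 1)`. -/
def kappa (g : ℝ) (n : ℕ) (ω : Fin B → ℝ) (b : Fin B) : ℝ :=
  Real.log (1 + g * n) / 2 + Real.log (1 / ω b - 1)

/-- Penalty difference `Δ(γ, γ̃) = Σ_b (p_{γ,b} − p_{γ̃,b}) κ_b`. -/
def Delta (z : ι → Fin B) (κ : Fin B → ℝ) (γ γt : Finset ι) : ℝ :=
  ∑ b : Fin B, ((blockCount z γ b : ℝ) - (blockCount z γt b : ℝ)) * κ b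

end Paper

open Paper

namespace Paper

section Rayleigh

variable {n : ℕ} {ι : Type*}

theorem gram_transpose (X : Fin n → ι → ℝ) (s : Finset ι) : (gram X s)ᵀ = gram X s := by
  simp [gram, Matrix.transpose_mul]

theorem smul_gram_quadForm (X : Fin n → ι → ℝ) (s : Finset ι) (c : ℝ) (x : {j // j ∈ s} → ℝ) :
    x ⬝ᵥ ((c • gram X s) *ᵥ x) = c * ∑ i, (subcols X s *ᵥ x) i ^ 2 := by
  rw [Matrix.smul_mulVec, dotProduct_smul, gram, ← Matrix.mulVec_mulVec,
    Matrix.dotProduct_mulVec, Matrix.vecMul_transpose, smul_eq_mul]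
  simp [dotProduct, sq]

theorem smul_gram_rayleigh_nonneg (X : Fin n → ι → ℝ) (s : Finset ι) {c : ℝ} (hc : 0 ≤ c)
    (x : {j // j ∈ s} → ℝ) : 0 ≤ (x ⬝ᵥ ((c • gram X s) *ᵥ x)) / (x ⬝ᵥ x) := by
  rw [smul_gram_quadForm]
  exact div_nonneg (mul_nonneg hc (Finset.sum_nonneg fun _ _ => sq_nonneg _))
    (Finset.sum_nonneg fun _ _ => mul_self_nonneg _)

theorem eigMin_smul_gram_nonneg (X : Fin n → ι → ℝ) (s : Finset ι) {c : ℝ} (hc : 0 ≤ c) :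
    0 ≤ eigMin (c • gram X s) :=
  Real.iInf_nonneg fun x => smul_gram_rayleigh_nonneg X s hc x.1

theorem eigMax_smul_gram_nonneg (X : Fin n → ι → ℝ) (s : Finset ι) {c : ℝ} (hc : 0 ≤ c) :
    0 ≤ eigMax (c • gram X s) :=
  Real.iSup_nonneg fun x => smul_gram_rayleigh_nonneg X s hc x.1

theorem dotProduct_self_pos {m : Type*} [Fintype m] {x : m → ℝ} (hx : x ≠ 0) : 0 < x ⬝ᵥ x :=
  lt_of_le_of_ne (Finset.sum_nonneg fun _ _ => mul_self_nonneg _)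
    fun h => hx (dotProduct_self_eq_zero.mp h.symm)

theorem eigMin_smul_gram_mul_le (X : Fin n → ι → ℝ) (s : Finset ι) {c : ℝ} (hc : 0 ≤ c)
    (x : {j // j ∈ s} → ℝ) :
    eigMin (c • gram X s) * (x ⬝ᵥ x) ≤ c * ∑ i, (subcols X s *ᵥ x) i ^ 2 := by
  by_cases hx : x = 0
  · simp [hx]
  rw [← smul_gram_quadForm, ← le_div_iff₀ (dotProduct_self_pos hx)]
  refine ciInf_le ⟨0, ?_⟩ (⟨x, hx⟩ : {v : {j // j ∈ s} → ℝ // v ≠ 0})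
  rintro _ ⟨y, rfl⟩
  exact smul_gram_rayleigh_nonneg X s hc y.1

theorem sum_sq_mulVec_le {m k : Type*} [Fintype m] [Fintype k] (A : Matrix m k ℝ) (x : k → ℝ) :
    ∑ i, (A *ᵥ x) i ^ 2 ≤ (∑ i, ∑ j, A i j ^ 2) * (x ⬝ᵥ x) := by
  rw [Finset.sum_mul]
  refine Finset.sum_le_sum fun i _ => ?_
  simpa [dotProduct, Matrix.mulVec, sq] using
    Finset.sum_mul_sq_le_sq_mul_sq Finset.univ (fun j => A i j) x

theorem le_eigMax_smul_gram_mul (X : Fin n → ι → ℝ) (s : Finset ι) {c : ℝ} (hc : 0 ≤ c)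
    (x : {j // j ∈ s} → ℝ) :
    c * ∑ i, (subcols X s *ᵥ x) i ^ 2 ≤ eigMax (c • gram X s) * (x ⬝ᵥ x) := by
  by_cases hx : x = 0
  · simp [hx]
  rw [← smul_gram_quadForm, ← div_le_iff₀ (dotProduct_self_pos hx)]
  refine le_ciSup (f := fun v : {v : {j // j ∈ s} → ℝ // v ≠ 0} =>
    (v.1 ⬝ᵥ ((c • gram X s) *ᵥ v.1)) / (v.1 ⬝ᵥ v.1))
    ⟨c * ∑ i, ∑ j, subcols X s i j ^ 2, ?_⟩ ⟨x, hx⟩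
  rintro _ ⟨y, rfl⟩
  simp only
  rw [div_le_iff₀ (dotProduct_self_pos y.2), smul_gram_quadForm, mul_assoc]
  exact mul_le_mul_of_nonneg_left (sum_sq_mulVec_le _ _) hc

theorem subcols_mulVec_restrict (X : Fin n → ι → ℝ) (s : Finset ι) (f : ι → ℝ) :
    subcols X s *ᵥ (fun j => f j) = colComb X f s := by
  ext i
  exact Finset.sum_coe_sort s fun j => X i j * f j

theorem dotProduct_restrict (s : Finset ι) (f : ι → ℝ) :
    (fun j : {j // j ∈ s} => f j) ⬝ᵥ (fun j => f j) = ∑ j ∈ s, f j ^ 2 := by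
  simp only [dotProduct, sq]
  exact Finset.sum_coe_sort s fun j => f j * f j

end Rayleigh

section Projection

variable {n : ℕ} {ι : Type*} [DecidableEq ι]

theorem projMat_transpose (X : Fin n → ι → ℝ) (s : Finset ι) :
    (projMat X s)ᵀ = projMat X s := by
  simp [projMat, Matrix.transpose_mul, Matrix.transpose_nonsing_inv, gram_transpose,
    Matrix.mul_assoc]

theorem nonsing_inv_mul_mul_nonsing_inv {m : Type*} [Fintype m] [DecidableEq m]
    (A : Matrix m m ℝ) : A⁻¹ * A * A⁻¹ = A⁻¹ := by
  by_cases h : IsUnit A.det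
  · rw [Matrix.nonsing_inv_mul A h, Matrix.one_mul]
  · simp [Matrix.nonsing_inv_apply_not_isUnit A h]

theorem projMat_mul_self (X : Fin n → ι → ℝ) (s : Finset ι) :
    projMat X s * projMat X s = projMat X s := by
  have h := nonsing_inv_mul_mul_nonsing_inv (gram X s)
  calc projMat X s * projMat X s
      = subcols X s * ((gram X s)⁻¹ * gram X s * (gram X s)⁻¹) * (subcols X s)ᵀ := by
        simp only [projMat, gram, Matrix.mul_assoc]
    _ = projMat X s := by rw [h, projMat]

theorem sum_sq_one_sub_projMat_le (X : Fin n → ι → ℝ) (s : Finset ι) (v : Fin n → ℝ) :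
    ∑ i, ((1 - projMat X s) *ᵥ v) i ^ 2 ≤ ∑ i, v i ^ 2 := by
  have h : (projMat X s *ᵥ v) ⬝ᵥ (projMat X s *ᵥ v) = v ⬝ᵥ (projMat X s *ᵥ v) := by
    nth_rewrite 1 [← projMat_transpose]
    rw [Matrix.mulVec_transpose, ← Matrix.dotProduct_mulVec, Matrix.mulVec_mulVec,
      projMat_mul_self]
  have h0 : 0 ≤ (projMat X s *ᵥ v) ⬝ᵥ (projMat X s *ᵥ v) :=
    Finset.sum_nonneg fun _ _ => mul_self_nonneg _
  have e : ∀ w : Fin n → ℝ, ∑ i, w i ^ 2 = w ⬝ᵥ w := fun w => by simp [dotProduct, sq]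
  rw [e, e, Matrix.sub_mulVec, Matrix.one_mulVec, sub_dotProduct, dotProduct_sub, dotProduct_sub,
    dotProduct_comm (projMat X s *ᵥ v) v]
  linarith

theorem exists_projMat_mulVec_eq_colComb (X : Fin n → ι → ℝ) (s : Finset ι) (v : Fin n → ℝ) :
    ∃ f : ι → ℝ, projMat X s *ᵥ v = colComb X f s := by
  refine ⟨fun j => if h : j ∈ s then lse X s v ⟨j, h⟩ else 0, ?_⟩
  rw [← subcols_mulVec_restrict]
  simp [projMat, lse, Matrix.mulVec_mulVec, Matrix.mul_assoc]

theorem colComb_eq_of_subset (X : Fin n → ι → ℝ) {s t : Finset ι} (hst : s ⊆ t) (f : ι → ℝ) :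
    colComb X f s = colComb X (fun j => if j ∈ s then f j else 0) t := by
  ext i
  simp only [colComb, mul_ite, mul_zero]
  rw [Finset.sum_ite_mem, Finset.inter_eq_right.mpr hst]

theorem sum_sq_colComb_le (X : Fin n → ι → ℝ) {s t : Finset ι} (hst : s ⊆ t) (f : ι → ℝ)
    {c : ℝ} (hc : 0 ≤ c) :
    c * ∑ i, colComb X f s i ^ 2 ≤ eigMax (c • gram X t) * ∑ j ∈ s, f j ^ 2 := by
  have h := le_eigMax_smul_gram_mul X t hc fun j => if (j : ι) ∈ s then f j else 0
  rw [subcols_mulVec_restrict X t fun j => if j ∈ s then f j else 0, ← colComb_eq_of_subset X hst,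
    dotProduct_restrict t fun j => if j ∈ s then f j else 0] at h
  simpa [ite_pow, Finset.sum_ite_mem, Finset.inter_eq_right.mpr hst] using h

theorem le_sum_sq_one_sub_projMat_colComb (X : Fin n → ι → ℝ) {r s t : Finset ι} (hrt : r ⊆ t)
    (hst : s ⊆ t) (hrs : Disjoint r s) (f : ι → ℝ) {c : ℝ} (hc : 0 ≤ c) :
    eigMin (c • gram X t) * ∑ j ∈ s, f j ^ 2 ≤
      c * ∑ i, ((1 - projMat X r) *ᵥ colComb X f s) i ^ 2 := by
  obtain ⟨a, ha⟩ := exists_projMat_mulVec_eq_colComb X r (colComb X f s)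
  let u : ι → ℝ := fun j => (if j ∈ s then f j else 0) - if j ∈ r then a j else 0
  have hu : (1 - projMat X r) *ᵥ colComb X f s = colComb X u t := by
    rw [Matrix.sub_mulVec, Matrix.one_mulVec, ha, colComb_eq_of_subset X hst,
      colComb_eq_of_subset X hrt]
    ext i
    simp [colComb, u, mul_sub, Finset.sum_sub_distrib]
  have h := eigMin_smul_gram_mul_le X t hc fun j => u j
  rw [subcols_mulVec_restrict, dotProduct_restrict] at h
  rw [hu]
  refine le_trans (mul_le_mul_of_nonneg_left ?_ (eigMin_smul_gram_nonneg X t hc)) h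
  calc ∑ j ∈ s, f j ^ 2 = ∑ j ∈ s, u j ^ 2 := Finset.sum_congr rfl fun j hj => by
        simp [u, hj, Finset.disjoint_right.mp hrs hj]
    _ ≤ ∑ j ∈ t, u j ^ 2 := Finset.sum_le_sum_of_subset_of_nonneg hst fun _ _ _ => sq_nonneg _

end Projection

section Blocks

variable {ι κ : Type*}

theorem finite_image_values (s : Finset ι) (f : ι → ℝ) : {r : ℝ | ∃ j ∈ s, r = f j}.Finite :=
  (s.finite_toSet.image f).subset fun _ ⟨j, hj, h⟩ => ⟨j, hj, h.symm⟩

theorem sum_le_sum_card_mul_sSup [Fintype κ] [DecidableEq κ] (s : Finset ι) (z : ι → κ)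
    (f : ι → ℝ) :
    ∑ j ∈ s, f j ≤ ∑ b, ((s.filter fun j => z j = b).card : ℝ) *
      sSup {r : ℝ | ∃ j ∈ s.filter (fun j => z j = b), r = f j} := by
  rw [← Finset.sum_fiberwise s z]
  refine Finset.sum_le_sum fun b _ => ?_
  rw [← nsmul_eq_mul]
  exact Finset.sum_le_card_nsmul _ _ _ fun j hj =>
    le_csSup (finite_image_values _ f).bddAbove ⟨j, hj, rfl⟩

theorem sum_card_mul_sInf_le_sum [Fintype κ] [DecidableEq κ] (s : Finset ι) (z : ι → κ)
    (f : ι → ℝ) :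
    ∑ b, ((s.filter fun j => z j = b).card : ℝ) *
      sInf {r : ℝ | ∃ j ∈ s.filter (fun j => z j = b), r = f j} ≤ ∑ j ∈ s, f j := by
  rw [← Finset.sum_fiberwise s z]
  refine Finset.sum_le_sum fun b _ => ?_
  rw [← nsmul_eq_mul]
  exact Finset.card_nsmul_le_sum _ _ _ fun j hj =>
    csInf_le (finite_image_values _ f).bddBelow ⟨j, hj, rfl⟩

end Blocks

end Paper

/-- **Two-sided bounds on the noncentrality parameter.**
In the Gaussian linear model with Zellner prior, for any considered `γ` and any
`γ̃ ⊆ γ*`, with `Γ(γ,γ̃) = γ ∪ γ̃`,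
`μ(Γ(γ,γ̃), γ̃) ≤ n φ⁻¹ λ̄ Σ_b |(γ*_b ∩ γ_b)∖γ̃_b| max_{i∈(γ*_b∩γ_b)∖γ̃_b} (θ*_i)²`
with `λ̄ = λ_max((1/n) X_{γ*}ᵀX_{γ*})`, and
`μ(Γ(γ,γ̃), γ̃) ≥ n φ⁻¹ λ_min((1/n) X_{γ*}ᵀX_{γ*}) Σ_b |(γ*_b ∩ γ_b)∖γ̃_b|
  min_{i∈(γ*_b∩γ_b)∖γ̃_b} (θ*_i)²`. -/
theorem stmt_9
    (n p B : ℕ) (X : Fin n → Fin p → ℝ) (θ : Fin p → ℝ)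
    (φ : ℝ) (hφ : 0 < φ)
    (z : Fin p → Fin B)
    (models : Finset (Finset (Fin p)))
    (γstar : Finset (Fin p)) (hγstar : ∀ j, j ∈ γstar ↔ θ j ≠ 0)
    (hrank : ∀ δ ∈ models, (subcols X δ).rank = δ.card)
    (hstar : γstar ∈ models)
    (γ γt : Finset (Fin p)) (hγ : γ ∈ models)
    (hsub : γt ⊆ γstar) :
    muNC X θ φ (γ ∪ γt) γt ≤
        (n : ℝ) * φ⁻¹ * eigMax ((n : ℝ)⁻¹ • gram X γstar) *
          ∑ b : Fin B, (((((γstar ∩ γ) \ γt).filter fun j => z j = b).card : ℝ) *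
            sSup {r : ℝ | ∃ j ∈ ((γstar ∩ γ) \ γt).filter (fun j => z j = b), r = θ j ^ 2}) ∧
      (n : ℝ) * φ⁻¹ * eigMin ((n : ℝ)⁻¹ • gram X γstar) *
          ∑ b : Fin B, (((((γstar ∩ γ) \ γt).filter fun j => z j = b).card : ℝ) *
            sInf {r : ℝ | ∃ j ∈ ((γstar ∩ γ) \ γt).filter (fun j => z j = b), r = θ j ^ 2})
        ≤ muNC X θ φ (γ ∪ γt) γt := by
  set T := (γstar ∩ γ) \ γt with hT
  have hTs : T ⊆ γstar := Finset.sdiff_subset.trans Finset.inter_subset_left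
  have hdisj : Disjoint γt T := Finset.disjoint_sdiff
  have hcol : colComb X θ ((γ ∪ γt) \ γt) = colComb X θ T := by
    ext i
    refine (Finset.sum_subset ?_ ?_).symm
    · intro j hj
      simp only [hT, Finset.mem_sdiff, Finset.mem_inter, Finset.mem_union] at hj ⊢
      tauto
    · intro j hj hjT
      have h0 : θ j = 0 := by
        by_contra h
        have hj' := (hγstar j).mpr h
        simp only [hT, Finset.mem_sdiff, Finset.mem_inter, Finset.mem_union] at hj hjT
        tauto
      rw [h0, mul_zero]
  rw [muNC, hcol]
  rcases Nat.eq_zero_or_pos n with rfl | hn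
  · simp
  have hn0 : (0 : ℝ) < n := Nat.cast_pos.mpr hn
  have hc : (0 : ℝ) ≤ (n : ℝ)⁻¹ := inv_nonneg.mpr hn0.le
  have hnφ : 0 ≤ (n : ℝ) * φ⁻¹ := mul_nonneg hn0.le (inv_nonneg.mpr hφ.le)
  have hscale : ∀ a : ℝ, φ⁻¹ * a = (n : ℝ) * φ⁻¹ * ((n : ℝ)⁻¹ * a) := fun a => by
    field_simp
  rw [hscale, mul_assoc ((n : ℝ) * φ⁻¹), mul_assoc ((n : ℝ) * φ⁻¹)]
  refine ⟨mul_le_mul_of_nonneg_left ?_ hnφ, mul_le_mul_of_nonneg_left ?_ hnφ⟩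
  · calc _ ≤ (n : ℝ)⁻¹ * ∑ i, colComb X θ T i ^ 2 :=
          mul_le_mul_of_nonneg_left (sum_sq_one_sub_projMat_le X γt _) hc
      _ ≤ _ := sum_sq_colComb_le X hTs θ hc
      _ ≤ _ := mul_le_mul_of_nonneg_left (sum_le_sum_card_mul_sSup T z fun j => θ j ^ 2)
          (eigMax_smul_gram_nonneg X γstar hc)
  · exact (mul_le_mul_of_nonneg_left (sum_card_mul_sInf_le_sum T z fun j => θ j ^ 2)
      (eigMin_smul_gram_nonneg X γstar hc)).trans
      (le_sum_sq_one_sub_projMat_colComb X hsub hTs hdisj θ hc)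
end
end
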